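/- arXiv:1809.06949 — 10 statements merged into one kernel-verified Lean document; each statement's English description precedes it below -/
import Mathlib

section
/- Let f : [−1,1] → ℝ be measurable with 0 < f(μ) < 1 for almost every μ ∈ [−1,1]. Define the angular moments J = (1/2)∫_{−1}^{1} f(μ) dμ and H = (1/2)∫_{−1}^{1} μ f(μ) dμ. Then 0 < J < 1 and |H| < J(1−J); i.e., (J, H) ∈ 𝓡_1. -/
open MeasureTheory

/-- The fermionic realizable set `𝓡_d`. -/
def realizableSet (d : ℕ) : Set (ℝ × EuclideanSpace ℝ (Fin d)) :=
  {M | 0 < M.1 ∧ M.1 < 1 ∧ ‖M.2‖ < M.1 * (1 - M.1)}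

lemma aux_pos {g : ℝ → ℝ} (hg : IntegrableOn g (Set.Icc (-1 : ℝ) 1))
    (h : ∀ᵐ x ∂(volume.restrict (Set.Icc (-1 : ℝ) 1)), 0 < g x) :
    0 < ∫ x in Set.Icc (-1 : ℝ) 1, g x := by
  have h0 : 0 ≤ᵐ[volume.restrict (Set.Icc (-1 : ℝ) 1)] g := by
    filter_upwards [h] with x hx using hx.le
  have h1 := integral_nonneg_of_ae h0
  refine lt_of_le_of_ne h1 (fun he => ?_)
  have h2 := (integral_eq_zero_iff_of_nonneg_ae h0 hg).1 he.symm
  have h3 : ∀ᵐ x ∂(volume.restrict (Set.Icc (-1 : ℝ) 1)), False := by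
    filter_upwards [h, h2] with x hx hy
    simp only [Pi.zero_apply] at hy
    linarith
  rw [Filter.eventually_false_iff_eq_bot, ae_eq_bot, Measure.restrict_eq_zero,
    Real.volume_Icc] at h3
  norm_num at h3

lemma aux_max (a : ℝ) (h1 : -1 < a) (h2 : a < 1) :
    ∫ x in (-1 : ℝ)..1, max (x - a) 0 = (1 - a) ^ 2 / 2 := by
  have hc : Continuous fun x : ℝ => max (x - a) 0 := by fun_prop
  rw [← intervalIntegral.integral_add_adjacent_intervals (b := a)
    (hc.intervalIntegrable _ _) (hc.intervalIntegrable _ _)]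
  have e1 : ∫ x in (-1 : ℝ)..a, max (x - a) 0 = ∫ x in (-1 : ℝ)..a, (0 : ℝ) := by
    apply intervalIntegral.integral_congr
    intro x hx
    rw [Set.uIcc_of_le h1.le] at hx
    exact max_eq_right (by linarith [hx.2])
  have e2 : ∫ x in a..1, max (x - a) 0 = ∫ x in a..1, (x - a) := by
    apply intervalIntegral.integral_congr
    intro x hx
    rw [Set.uIcc_of_le h2.le] at hx
    exact max_eq_left (by linarith [hx.1])
  rw [e1, e2, intervalIntegral.integral_sub (by simp) (by simp)]
  simp
  ring

lemma aux_main (f : ℝ → ℝ) (s a : ℝ) (hs : s = 1 ∨ s = -1) (h1 : -1 < a) (h2 : a < 1)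
    (hbounds : ∀ᵐ μ ∂(volume.restrict (Set.Icc (-1 : ℝ) 1)), 0 < f μ ∧ f μ < 1)
    (hi : IntegrableOn f (Set.Icc (-1 : ℝ) 1))
    (hi' : IntegrableOn (fun x => x * f x) (Set.Icc (-1 : ℝ) 1)) :
    s * (∫ x in Set.Icc (-1 : ℝ) 1, x * f x) - a * (∫ x in Set.Icc (-1 : ℝ) 1, f x)
      < (1 - a) ^ 2 / 2 := by
  have hc : Continuous fun x : ℝ => max (s * x - a) 0 := by fun_prop
  have hci : IntegrableOn (fun x : ℝ => max (s * x - a) 0) (Set.Icc (-1 : ℝ) 1) :=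
    hc.continuousOn.integrableOn_Icc
  have hm : ∫ x in Set.Icc (-1 : ℝ) 1, max (s * x - a) 0 = (1 - a) ^ 2 / 2 := by
    rw [integral_Icc_eq_integral_Ioc, ← intervalIntegral.integral_of_le (by norm_num)]
    rcases hs with rfl | rfl
    · simpa using aux_max a h1 h2
    · have := intervalIntegral.integral_comp_neg (a := -1) (b := 1)
        (fun x : ℝ => max (x - a) 0)
      rw [neg_neg, aux_max a h1 h2] at this
      simpa using this
  have hd : IntegrableOn (fun x => s * (x * f x) - a * f x) (Set.Icc (-1 : ℝ) 1) :=
    (hi'.const_mul s).sub (hi.const_mul a)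
  have hp : 0 < ∫ x in Set.Icc (-1 : ℝ) 1,
      (max (s * x - a) 0 - (s * (x * f x) - a * f x)) := by
    apply aux_pos (hci.sub hd)
    have hne : ∀ᵐ x ∂(volume.restrict (Set.Icc (-1 : ℝ) 1)), x ≠ s * a :=
      ae_restrict_of_ae (Measure.ae_ne volume (s * a))
    filter_upwards [hbounds, hne] with x hx hxa
    simp only [Pi.sub_apply]
    have hn : s * x - a ≠ 0 := by
      intro h
      apply hxa
      rcases hs with rfl | rfl <;> linarith
    rcases lt_or_gt_of_ne hn with h | h
    · rw [max_eq_right h.le]; nlinarith [mul_pos (neg_pos.2 h) hx.1]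
    · rw [max_eq_left h.le]; nlinarith [mul_pos h (sub_pos.2 hx.2)]
  rw [integral_sub hci hd, integral_sub (hi'.const_mul s) (hi.const_mul a),
    integral_const_mul, integral_const_mul, hm] at hp
  linarith

theorem moments_realizable_of_ae_bounds
    (f : ℝ → ℝ) (hf : Measurable f)
    (hbounds : ∀ᵐ μ ∂(volume.restrict (Set.Icc (-1 : ℝ) 1)), 0 < f μ ∧ f μ < 1)
    (J H : ℝ)
    (hJ : J = (1 / 2) * ∫ μ in Set.Icc (-1 : ℝ) 1, f μ)
    (hH : H = (1 / 2) * ∫ μ in Set.Icc (-1 : ℝ) 1, μ * f μ) :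
    (0 < J ∧ J < 1 ∧ |H| < J * (1 - J)) ∧
      (J, (EuclideanSpace.equiv (Fin 1) ℝ).symm (fun _ => H)) ∈ realizableSet 1 := by
  have hone : IntegrableOn (fun _ : ℝ => (1 : ℝ)) (Set.Icc (-1 : ℝ) 1) :=
    continuous_const.continuousOn.integrableOn_Icc
  have hi : IntegrableOn f (Set.Icc (-1 : ℝ) 1) := by
    refine Integrable.mono' hone hf.aestronglyMeasurable ?_
    filter_upwards [hbounds] with x hx
    rw [Real.norm_eq_abs, abs_of_pos hx.1]
    exact hx.2.le
  have hi' : IntegrableOn (fun x => x * f x) (Set.Icc (-1 : ℝ) 1) := by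
    refine Integrable.mono' hone (measurable_id.mul hf).aestronglyMeasurable ?_
    filter_upwards [hbounds, ae_restrict_mem measurableSet_Icc] with x hx hm
    rw [Real.norm_eq_abs, abs_mul, abs_of_pos hx.1]
    have := abs_le.2 hm
    nlinarith [abs_nonneg x, hx.1, hx.2]
  have p1 := aux_pos hi (hbounds.mono fun x hx => hx.1)
  have p2 := aux_pos (hone.sub hi) (hbounds.mono fun x hx => sub_pos.2 hx.2)
  have p3 : ∫ x in Set.Icc (-1 : ℝ) 1, ((fun _ : ℝ => (1 : ℝ)) - f) x
      = 2 - ∫ x in Set.Icc (-1 : ℝ) 1, f x := by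
    simp only [Pi.sub_apply]
    rw [integral_sub hone hi]
    simp
    norm_num
  rw [p3] at p2
  have hJ0 : 0 < J := by linarith
  have hJ1 : J < 1 := by linarith
  have q1 := aux_main f 1 (1 - 2 * J) (Or.inl rfl) (by linarith) (by linarith) hbounds hi hi'
  have q2 := aux_main f (-1) (1 - 2 * J) (Or.inr rfl) (by linarith) (by linarith) hbounds hi hi'
  have eJ : ∫ x in Set.Icc (-1 : ℝ) 1, f x = 2 * J := by linarith
  have eH : ∫ x in Set.Icc (-1 : ℝ) 1, x * f x = 2 * H := by linarith
  rw [eJ, eH] at q1 q2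
  have hb : |H| < J * (1 - J) := by
    rw [abs_lt]
    constructor <;> nlinarith
  refine ⟨⟨hJ0, hJ1, hb⟩, hJ0, hJ1, ?_⟩
  simpa [EuclideanSpace.norm_eq, Real.sqrt_sq_eq_abs] using hb
end

section
/- Let f : S² → ℝ be measurable on the unit sphere S² ⊂ ℝ³ with 0 < f(ω) < 1 for almost every ω (with respect to the surface measure). Define J = (1/(4π))∫_{S²} f(ω) dω ∈ ℝ and H = (1/(4π))∫_{S²} ω f(ω) dω ∈ ℝ³. Then 0 < J < 1 and ‖H‖ < J(1−J); i.e., (J, H) ∈ 𝓡_3. -/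
open MeasureTheory Metric Real

/-- The surface measure on the unit sphere `S² ⊂ ℝ³`. -/
noncomputable def sphereMeasure : Measure (sphere (0 : EuclideanSpace ℝ (Fin 3)) 1) :=
  (volume : Measure (EuclideanSpace ℝ (Fin 3))).toSphere

lemma sm_disc (R : ℝ) : volume {y : Fin 2 → ℝ | y 0 ^ 2 + y 1 ^ 2 < R} = ENNReal.ofReal (π * R) := by
  rcases le_or_gt R 0 with hR | hR
  · rw [ENNReal.ofReal_of_nonpos (mul_nonpos_of_nonneg_of_nonpos pi_pos.le hR)]
    have : {y : Fin 2 → ℝ | y 0 ^ 2 + y 1 ^ 2 < R} = ∅ := by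
      ext y; simp; nlinarith [sq_nonneg (y 0), sq_nonneg (y 1)]
    rw [this]; simp
  · have hm : MeasurableSet {y : Fin 2 → ℝ | y 0 ^ 2 + y 1 ^ 2 < R} :=
      measurableSet_lt (by fun_prop) (by fun_prop)
    rw [← (PiLp.volume_preserving_ofLp (Fin 2)).measure_preimage hm.nullMeasurableSet]
    have : (WithLp.ofLp ⁻¹' {y : Fin 2 → ℝ | y 0 ^ 2 + y 1 ^ 2 < R} : Set (EuclideanSpace ℝ (Fin 2)))
        = ball 0 (√R) := by
      ext y
      simp only [Set.mem_preimage, Set.mem_ofPred_eq, mem_ball_zero_iff]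
      rw [Real.lt_sqrt (norm_nonneg _), EuclideanSpace.real_norm_sq_eq, Fin.sum_univ_two]
    rw [this, EuclideanSpace.volume_ball_fin_two, ← ENNReal.ofReal_pow (Real.sqrt_nonneg _),
      Real.sq_sqrt hR.le, ← ENNReal.ofReal_mul hR.le, mul_comm]

lemma sm_lint (g : ℝ → ℝ) (hg : Continuous g) (a b : ℝ) (hab : a ≤ b)
    (h : ∀ x ∈ Set.Ioc a b, 0 ≤ g x) :
    ∫⁻ x, (Set.Ioc a b).indicator (fun x => ENNReal.ofReal (g x)) x
      = ENNReal.ofReal (∫ x in a..b, g x) := by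
  rw [lintegral_indicator measurableSet_Ioc, intervalIntegral.integral_of_le hab,
    ofReal_integral_eq_lintegral_ofReal]
  · exact (hg.integrableOn_Icc).mono_set Set.Ioc_subset_Icc_self
  · exact (ae_restrict_iff' measurableSet_Ioc).2 (Filter.Eventually.of_forall h)

lemma sm_meas (c : ℝ) : MeasurableSet {p : ℝ × (Fin 2 → ℝ) | 0 < p.1 ∧ p.1 ^ 2 + (p.2 0 ^ 2 + p.2 1 ^ 2) < 1 ∧
      c ^ 2 * (p.1 ^ 2 + (p.2 0 ^ 2 + p.2 1 ^ 2)) < p.1 ^ 2} := by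
  have h1 : MeasurableSet {p : ℝ × (Fin 2 → ℝ) | 0 < p.1} :=
    measurableSet_lt (by fun_prop) (by fun_prop)
  have h2 : MeasurableSet {p : ℝ × (Fin 2 → ℝ) | p.1 ^ 2 + (p.2 0 ^ 2 + p.2 1 ^ 2) < 1} :=
    measurableSet_lt (by fun_prop) (by fun_prop)
  have h3 : MeasurableSet {p : ℝ × (Fin 2 → ℝ) |
      c ^ 2 * (p.1 ^ 2 + (p.2 0 ^ 2 + p.2 1 ^ 2)) < p.1 ^ 2} :=
    measurableSet_lt (by fun_prop) (by fun_prop)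
  exact h1.inter (h2.inter h3)

lemma sm_cone_prod (c : ℝ) (hc : 0 < c) (hc1 : c < 1) :
    volume {p : ℝ × (Fin 2 → ℝ) | 0 < p.1 ∧ p.1 ^ 2 + (p.2 0 ^ 2 + p.2 1 ^ 2) < 1 ∧
      c ^ 2 * (p.1 ^ 2 + (p.2 0 ^ 2 + p.2 1 ^ 2)) < p.1 ^ 2}
      = ENNReal.ofReal (2 * π / 3 * (1 - c)) := by
  have hm : MeasurableSet {p : ℝ × (Fin 2 → ℝ) | 0 < p.1 ∧ p.1 ^ 2 + (p.2 0 ^ 2 + p.2 1 ^ 2) < 1 ∧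
      c ^ 2 * (p.1 ^ 2 + (p.2 0 ^ 2 + p.2 1 ^ 2)) < p.1 ^ 2} := by
    exact sm_meas c
  rw [Measure.volume_eq_prod, Measure.prod_apply hm]
  have hc2 : 0 < c ^ 2 := by positivity
  have key : ∀ z : ℝ, volume (Prod.mk z ⁻¹' {p : ℝ × (Fin 2 → ℝ) | 0 < p.1 ∧
      p.1 ^ 2 + (p.2 0 ^ 2 + p.2 1 ^ 2) < 1 ∧
      c ^ 2 * (p.1 ^ 2 + (p.2 0 ^ 2 + p.2 1 ^ 2)) < p.1 ^ 2}) =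
      (Set.Ioc 0 c).indicator (fun z => ENNReal.ofReal (π * (z ^ 2 / c ^ 2 - z ^ 2))) z +
      (Set.Ioc c 1).indicator (fun z => ENNReal.ofReal (π * (1 - z ^ 2))) z := by
    intro z
    have hiff : ∀ q : ℝ, c ^ 2 * (z ^ 2 + q) < z ^ 2 ↔ q < z ^ 2 / c ^ 2 - z ^ 2 := by
      intro q
      rw [lt_sub_iff_add_lt, lt_div_iff₀ hc2, mul_comm, add_comm]
    rcases le_or_gt z 0 with h0 | h0
    · have : (Prod.mk z ⁻¹' {p : ℝ × (Fin 2 → ℝ) | 0 < p.1 ∧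
        p.1 ^ 2 + (p.2 0 ^ 2 + p.2 1 ^ 2) < 1 ∧
        c ^ 2 * (p.1 ^ 2 + (p.2 0 ^ 2 + p.2 1 ^ 2)) < p.1 ^ 2}) = ∅ := by
        ext y; simp; intro h; linarith
      rw [this, Set.indicator_of_notMem (by simp; intro h; linarith),
        Set.indicator_of_notMem (by simp; intro h; linarith)]
      simp
    rcases le_or_gt z c with h1 | h1
    · have hzc : z ^ 2 / c ^ 2 ≤ 1 := by
        rw [div_le_one hc2]; nlinarith
      have : (Prod.mk z ⁻¹' {p : ℝ × (Fin 2 → ℝ) | 0 < p.1 ∧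
        p.1 ^ 2 + (p.2 0 ^ 2 + p.2 1 ^ 2) < 1 ∧
        c ^ 2 * (p.1 ^ 2 + (p.2 0 ^ 2 + p.2 1 ^ 2)) < p.1 ^ 2}) =
          {y | y 0 ^ 2 + y 1 ^ 2 < z ^ 2 / c ^ 2 - z ^ 2} := by
        ext y
        simp only [Set.mem_preimage, Set.mem_ofPred_eq, hiff]
        constructor
        · rintro ⟨_, _, h⟩; exact h
        · intro h; exact ⟨h0, by linarith, h⟩
      rw [this, sm_disc, Set.indicator_of_mem (show z ∈ Set.Ioc 0 c from ⟨h0, h1⟩),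
        Set.indicator_of_notMem (by simp; intro h; linarith)]
      simp
    · have hzc : 1 ≤ z ^ 2 / c ^ 2 := by
        rw [le_div_iff₀ hc2]; nlinarith
      have : (Prod.mk z ⁻¹' {p : ℝ × (Fin 2 → ℝ) | 0 < p.1 ∧
        p.1 ^ 2 + (p.2 0 ^ 2 + p.2 1 ^ 2) < 1 ∧
        c ^ 2 * (p.1 ^ 2 + (p.2 0 ^ 2 + p.2 1 ^ 2)) < p.1 ^ 2}) =
          {y | y 0 ^ 2 + y 1 ^ 2 < 1 - z ^ 2} := by
        ext y
        simp only [Set.mem_preimage, Set.mem_ofPred_eq, hiff]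
        constructor
        · rintro ⟨_, h, _⟩; linarith
        · intro h; exact ⟨h0, by linarith, by linarith⟩
      rw [this, sm_disc, Set.indicator_of_notMem (by simp; intro h; linarith)]
      rcases le_or_gt z 1 with h2 | h2
      · rw [Set.indicator_of_mem (show z ∈ Set.Ioc c 1 from ⟨h1, h2⟩)]; simp
      · rw [Set.indicator_of_notMem (by simp; intro h; linarith), ENNReal.ofReal_of_nonpos]
        · simp
        · exact mul_nonpos_of_nonneg_of_nonpos pi_pos.le (by nlinarith)
  simp_rw [key]
  rw [lintegral_add_left, sm_lint _ (by fun_prop) _ _ hc.le, sm_lint _ (by fun_prop) _ _ hc1.le,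
    ← ENNReal.ofReal_add]
  · congr 1
    have e1 : ∫ z in (0:ℝ)..c, π * (z ^ 2 / c ^ 2 - z ^ 2) = π * ((c ^ 3 / 3) / c ^ 2 - c ^ 3 / 3) := by
      rw [intervalIntegral.integral_const_mul, intervalIntegral.integral_sub,
        intervalIntegral.integral_div, integral_pow]
      · norm_num
      all_goals exact Continuous.intervalIntegrable (by fun_prop) _ _
    have e2 : ∫ z in c..1, π * (1 - z ^ 2) = π * ((1 - c) - (1 - c ^ 3) / 3) := by
      rw [intervalIntegral.integral_const_mul, intervalIntegral.integral_sub, integral_pow]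
      · norm_num
      all_goals exact Continuous.intervalIntegrable (by fun_prop) _ _
    rw [e1, e2]
    field_simp
    ring
  · apply intervalIntegral.integral_nonneg hc.le
    intro z hz
    have : z ^ 2 ≤ z ^ 2 / c ^ 2 := by
      rw [le_div_iff₀ hc2]; exact mul_le_of_le_one_right (sq_nonneg z) (by nlinarith)
    exact mul_nonneg pi_pos.le (by linarith)
  · apply intervalIntegral.integral_nonneg hc1.le
    intro z hz
    exact mul_nonneg pi_pos.le (by nlinarith [hz.1, hz.2])
  · intro z hz
    exact mul_nonneg pi_pos.le (by nlinarith [hz.1, hz.2])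
  · intro z hz
    have : z ^ 2 ≤ z ^ 2 / c ^ 2 := by
      rw [le_div_iff₀ hc2]; exact mul_le_of_le_one_right (sq_nonneg z) (by nlinarith)
    exact mul_nonneg pi_pos.le (by linarith)
  · exact Measurable.indicator (by fun_prop) measurableSet_Ioc

lemma sm_cone (e : EuclideanSpace ℝ (Fin 3)) (he : ‖e‖ = 1) (c : ℝ) (hc : 0 < c) (hc1 : c < 1) :
    volume {x : EuclideanSpace ℝ (Fin 3) | ‖x‖ < 1 ∧ c * ‖x‖ < inner ℝ e x}
      = ENNReal.ofReal (2 * π / 3 * (1 - c)) := by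
  obtain ⟨b, hb⟩ := Orthonormal.exists_orthonormalBasis_extension_of_card_eq (𝕜 := ℝ)
    (E := EuclideanSpace ℝ (Fin 3)) (ι := Fin 3) (by simp) (v := fun _ => e) (s := {0}) (by
      constructor
      · intro i; simpa using he
      · intro i j hij; exact absurd (Subsingleton.elim i j) hij)
  have hb0 : b 0 = e := hb 0 rfl
  rw [← sm_cone_prod c hc hc1]
  have mp := ((volume_preserving_piFinSuccAbove (fun _ : Fin 3 => ℝ) 0).comp
    (PiLp.volume_preserving_ofLp (Fin 3))).comp b.measurePreserving_repr
  rw [← mp.measure_preimage]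
  · congr 1
    ext x
    have h0 : b.repr x 0 = inner ℝ e x := by rw [b.repr_apply_apply, hb0]
    have hn : ‖x‖ ^ 2 = b.repr x 0 ^ 2 + (b.repr x 1 ^ 2 + b.repr x 2 ^ 2) := by
      rw [← b.repr.norm_map x, EuclideanSpace.real_norm_sq_eq, Fin.sum_univ_three]; ring
    change _ ↔ (0 < b.repr x 0 ∧ b.repr x 0 ^ 2 + (b.repr x 1 ^ 2 + b.repr x 2 ^ 2) < 1 ∧
      c ^ 2 * (b.repr x 0 ^ 2 + (b.repr x 1 ^ 2 + b.repr x 2 ^ 2)) < b.repr x 0 ^ 2)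
    rw [← hn, h0, ← mul_pow]
    have hx := norm_nonneg x
    have hcx : 0 ≤ c * ‖x‖ := by positivity
    constructor
    · rintro ⟨h1, h2⟩
      exact ⟨by linarith, by nlinarith, by gcongr⟩
    · rintro ⟨h1, h2, h3⟩
      exact ⟨by nlinarith, lt_of_pow_lt_pow_left₀ 2 h1.le h3⟩
  · apply MeasurableSet.nullMeasurableSet
    exact sm_meas c

instance sm_fin : IsFiniteMeasure sphereMeasure := by
  unfold sphereMeasure; infer_instance

lemma sm_univ : sphereMeasure.real Set.univ = 4 * π := by
  unfold sphereMeasure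
  rw [Measure.toSphere_real_apply_univ, measureReal_def, EuclideanSpace.volume_ball_fin_three]
  simp
  rw [ENNReal.toReal_ofReal (by positivity)]; ring

open scoped Pointwise in
lemma sm_cap (e : EuclideanSpace ℝ (Fin 3)) (he : ‖e‖ = 1) (c : ℝ) (hc : 0 < c) (hc1 : c < 1) :
    sphereMeasure.real {ω | c < inner ℝ e (ω : EuclideanSpace ℝ (Fin 3))} = 2 * π * (1 - c) := by
  have hm : MeasurableSet {ω : sphere (0 : EuclideanSpace ℝ (Fin 3)) 1 |
      c < inner ℝ e (ω : EuclideanSpace ℝ (Fin 3))} :=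
    measurableSet_lt (by fun_prop) (by fun_prop)
  unfold sphereMeasure
  rw [measureReal_def, Measure.toSphere_apply' _ hm]
  have : (Set.Ioo (0 : ℝ) 1 • (Subtype.val '' {ω : sphere (0 : EuclideanSpace ℝ (Fin 3)) 1 |
      c < inner ℝ e (ω : EuclideanSpace ℝ (Fin 3))}) : Set (EuclideanSpace ℝ (Fin 3))) =
      {x : EuclideanSpace ℝ (Fin 3) | ‖x‖ < 1 ∧ c * ‖x‖ < inner ℝ e x} := by
    ext x
    rw [Set.mem_smul]
    constructor
    · rintro ⟨r, ⟨hr0, hr1⟩, _, ⟨ω, hω, rfl⟩, rfl⟩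
      have hn : ‖(ω : EuclideanSpace ℝ (Fin 3))‖ = 1 := by simp
      simp only [Set.mem_ofPred_eq] at hω ⊢
      rw [norm_smul, hn, inner_smul_right, Real.norm_of_nonneg hr0.le]
      exact ⟨by linarith, by nlinarith⟩
    · rintro ⟨h1, h2⟩
      have hx : 0 < ‖x‖ := by
        rw [norm_pos_iff]; rintro rfl; simp at h2
      refine ⟨‖x‖, ⟨hx, h1⟩, ‖x‖⁻¹ • x, ⟨⟨‖x‖⁻¹ • x, ?_⟩, ?_, rfl⟩, ?_⟩
      · simp [norm_smul, hx.ne']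
      · simp only [Set.mem_ofPred_eq, inner_smul_right]
        rw [inv_mul_eq_div, lt_div_iff₀ hx]; exact h2
      · rw [smul_smul, mul_inv_cancel₀ hx.ne', one_smul]
  rw [this, sm_cone e he c hc hc1]
  simp
  rw [ENNReal.toReal_ofReal (mul_nonneg (by positivity) (by linarith))]; ring

lemma sm_bdd (e : EuclideanSpace ℝ (Fin 3)) (he : ‖e‖ = 1)
    (ω : sphere (0 : EuclideanSpace ℝ (Fin 3)) 1) :
    |inner ℝ e (ω : EuclideanSpace ℝ (Fin 3))| ≤ 1 := by
  have := abs_real_inner_le_norm e (ω : EuclideanSpace ℝ (Fin 3))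
  simpa [he] using this

lemma sm_int_inner (e : EuclideanSpace ℝ (Fin 3)) (he : ‖e‖ = 1) :
    Integrable (fun ω : sphere (0 : EuclideanSpace ℝ (Fin 3)) 1 =>
      inner ℝ e (ω : EuclideanSpace ℝ (Fin 3))) sphereMeasure := by
  refine Integrable.of_bound (C := 1) (Measurable.aestronglyMeasurable (by fun_prop)) ?_
  exact Filter.Eventually.of_forall fun ω => sm_bdd e he ω

lemma sm_int_max (e : EuclideanSpace ℝ (Fin 3)) (he : ‖e‖ = 1) (c : ℝ) :
    Integrable (fun ω : sphere (0 : EuclideanSpace ℝ (Fin 3)) 1 =>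
      max (inner ℝ e (ω : EuclideanSpace ℝ (Fin 3)) - c) 0) sphereMeasure :=
  ((sm_int_inner e he).sub (integrable_const c)).pos_part

lemma sm_F_nonneg (e : EuclideanSpace ℝ (Fin 3)) (he : ‖e‖ = 1) (c : ℝ) (hc : 0 ≤ c) (hc1 : c ≤ 1) :
    ∫ ω, max (inner ℝ e (ω : EuclideanSpace ℝ (Fin 3)) - c) 0 ∂sphereMeasure = π * (1 - c) ^ 2 := by
  rw [(sm_int_max e he c).integral_eq_integral_meas_lt
    (Filter.Eventually.of_forall fun ω => le_max_right _ _)]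
  have key : ∀ t ∈ Set.Ioi (0:ℝ), sphereMeasure.real
      {ω | t < max (inner ℝ e (ω : EuclideanSpace ℝ (Fin 3)) - c) 0} =
      (Set.Ioc 0 (1 - c)).indicator (fun t => 2 * π * (1 - c - t)) t := by
    intro t ht
    have ht : 0 < t := ht
    have hs : {ω : sphere (0 : EuclideanSpace ℝ (Fin 3)) 1 |
        t < max (inner ℝ e (ω : EuclideanSpace ℝ (Fin 3)) - c) 0} =
        {ω : sphere (0 : EuclideanSpace ℝ (Fin 3)) 1 | c + t < inner ℝ e (ω : EuclideanSpace ℝ (Fin 3))} := by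
      ext ω
      simp only [Set.mem_ofPred_eq, lt_max_iff]
      constructor
      · rintro (h | h) <;> linarith
      · intro h; left; linarith
    rw [hs]
    rcases lt_or_ge (c + t) 1 with h | h
    · rw [sm_cap e he _ (by linarith) h, Set.indicator_of_mem (show t ∈ Set.Ioc 0 (1 - c) from ⟨ht, by linarith⟩)]; ring
    · have : {ω : sphere (0 : EuclideanSpace ℝ (Fin 3)) 1 |
        c + t < inner ℝ e (ω : EuclideanSpace ℝ (Fin 3))} = ∅ := by
        ext ω
        simp only [Set.mem_ofPred_eq, Set.mem_empty_iff_false, iff_false, not_lt]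
        linarith [(abs_le.1 (sm_bdd e he ω)).2]
      rw [this]
      by_cases h2 : t ∈ Set.Ioc 0 (1 - c)
      · rw [Set.indicator_of_mem h2]
        have : 1 - c - t = 0 := by linarith [h2.2]
        simp [this]
      · rw [Set.indicator_of_notMem h2]; simp
  rw [setIntegral_congr_fun measurableSet_Ioi key, setIntegral_indicator measurableSet_Ioc,
    Set.inter_eq_right.2 (fun x hx => hx.1), ← intervalIntegral.integral_of_le (by linarith),
    intervalIntegral.integral_const_mul, intervalIntegral.integral_sub, integral_id]
  · simp; ring
  all_goals exact Continuous.intervalIntegrable (by fun_prop) _ _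

lemma sm_F (e : EuclideanSpace ℝ (Fin 3)) (he : ‖e‖ = 1) (c : ℝ) (hc : -1 ≤ c) (hc1 : c ≤ 1) :
    ∫ ω, max (inner ℝ e (ω : EuclideanSpace ℝ (Fin 3)) - c) 0 ∂sphereMeasure = π * (1 - c) ^ 2 := by
  rcases le_or_gt 0 c with h | h
  · exact sm_F_nonneg e he c h hc1
  have hne : ‖-e‖ = 1 := by simpa using he
  have hdec : ∀ d : ℝ, ∫ ω, max (inner ℝ e (ω : EuclideanSpace ℝ (Fin 3)) - d) 0 ∂sphereMeasure =
      ∫ ω, inner ℝ e (ω : EuclideanSpace ℝ (Fin 3)) ∂sphereMeasure - 4 * π * d +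
      ∫ ω, max (inner ℝ (-e) (ω : EuclideanSpace ℝ (Fin 3)) - (-d)) 0 ∂sphereMeasure := by
    intro d
    have : 4 * π * d = ∫ ω, d ∂sphereMeasure := by
      rw [integral_const, sm_univ]; rfl
    rw [this, ← integral_sub (sm_int_inner e he) (integrable_const d), ← integral_add
      (by exact (sm_int_inner e he).sub (integrable_const d)) (sm_int_max _ hne _)]
    congr 1
    ext ω
    rw [inner_neg_left]
    rcases le_total (inner ℝ e (ω : EuclideanSpace ℝ (Fin 3))) d with h | h
    · rw [max_eq_right (by linarith), max_eq_left (by linarith)]; ring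
    · rw [max_eq_left (by linarith), max_eq_right (by linarith)]; ring
  have h0 := hdec 0
  rw [sm_F_nonneg e he 0 le_rfl (by norm_num), neg_zero,
    sm_F_nonneg (-e) hne 0 le_rfl (by norm_num)] at h0
  rw [hdec c, sm_F_nonneg (-e) hne (-c) (by linarith) (by linarith)]
  nlinarith

lemma sm_pos (g : sphere (0 : EuclideanSpace ℝ (Fin 3)) 1 → ℝ) (hg : Integrable g sphereMeasure)
    (h : ∀ᵐ ω ∂sphereMeasure, 0 < g ω) : 0 < ∫ ω, g ω ∂sphereMeasure := by
  have h1 : 0 ≤ᵐ[sphereMeasure] g := h.mono fun _ h => h.le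
  refine lt_of_le_of_ne (integral_nonneg_of_ae h1) fun h0 => ?_
  have h2 := (integral_eq_zero_iff_of_nonneg_ae h1 hg).1 h0.symm
  have h3 : ∀ᵐ ω ∂sphereMeasure, False := by
    filter_upwards [h, h2] with ω a b
    simp at b; linarith
  have h4 := sm_univ
  have h5 : sphereMeasure = 0 := by simpa using h3
  rw [h5] at h4
  simp at h4

theorem sphere_moments_realizable
    (f : sphere (0 : EuclideanSpace ℝ (Fin 3)) 1 → ℝ) (hf : Measurable f)
    (hbounds : ∀ᵐ ω ∂sphereMeasure, 0 < f ω ∧ f ω < 1)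
    (J : ℝ) (H : EuclideanSpace ℝ (Fin 3))
    (hJ : J = (1 / (4 * π)) * ∫ ω, f ω ∂sphereMeasure)
    (hH : H = (1 / (4 * π)) • ∫ ω, f ω • (ω : EuclideanSpace ℝ (Fin 3)) ∂sphereMeasure) :
    (J, H) ∈ realizableSet 3 := by
  have hfi : Integrable f sphereMeasure := by
    refine Integrable.of_bound (C := 1) hf.aestronglyMeasurable ?_
    filter_upwards [hbounds] with ω h
    rw [Real.norm_of_nonneg h.1.le]; exact h.2.le
  have hpi := pi_pos
  have hIf : ∫ ω, f ω ∂sphereMeasure = 4 * π * J := by rw [hJ]; field_simp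
  have hJ0 : 0 < J := by
    have := sm_pos f hfi (hbounds.mono fun _ h => h.1)
    rw [hIf] at this
    exact pos_of_mul_pos_right this (by positivity)
  have hJ1 : J < 1 := by
    have := sm_pos (fun ω => 1 - f ω) ((integrable_const 1).sub hfi)
      (hbounds.mono fun _ h => by linarith [h.2])
    rw [integral_sub (integrable_const 1) hfi, hIf, integral_const, sm_univ] at this
    simp only [smul_eq_mul] at this
    nlinarith
  refine ⟨hJ0, hJ1, ?_⟩
  change ‖H‖ < J * (1 - J)
  rcases eq_or_ne H 0 with h0 | h0
  · rw [h0, norm_zero]; exact mul_pos hJ0 (by linarith)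
  obtain ⟨e, he, heH⟩ : ∃ e : EuclideanSpace ℝ (Fin 3), ‖e‖ = 1 ∧ inner ℝ e H = ‖H‖ := by
    have hn : ‖H‖ ≠ 0 := norm_ne_zero_iff.2 h0
    refine ⟨‖H‖⁻¹ • H, by simp [norm_smul, hn], ?_⟩
    rw [real_inner_smul_left, real_inner_self_eq_norm_sq]; field_simp
  have hvi : Integrable (fun ω => f ω • (ω : EuclideanSpace ℝ (Fin 3))) sphereMeasure := by
    refine Integrable.of_bound (C := 1) (Measurable.aestronglyMeasurable (by fun_prop)) ?_
    filter_upwards [hbounds] with ω h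
    rw [norm_smul, Real.norm_of_nonneg h.1.le]
    simpa using h.2.le
  have hfei : Integrable (fun ω => f ω * inner ℝ e (ω : EuclideanSpace ℝ (Fin 3)))
      sphereMeasure := by
    have := hvi.const_inner (𝕜 := ℝ) e
    simpa only [inner_smul_right] using this
  have hIH : ∫ ω, f ω * inner ℝ e (ω : EuclideanSpace ℝ (Fin 3)) ∂sphereMeasure
      = 4 * π * ‖H‖ := by
    have h1 := integral_inner (𝕜 := ℝ) hvi e
    simp only [inner_smul_right] at h1
    rw [h1, ← heH, hH, inner_smul_right]; field_simp
  have hF := sm_F e he (1 - 2 * J) (by linarith) (by linarith)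
  have hmi := sm_int_max e he (1 - 2 * J)
  have hgi : Integrable (fun ω => f ω * inner ℝ e (ω : EuclideanSpace ℝ (Fin 3))
      - (1 - 2 * J) * f ω) sphereMeasure := hfei.sub (hfi.const_mul _)
  have hIg : ∫ ω, (f ω * inner ℝ e (ω : EuclideanSpace ℝ (Fin 3))
      - (1 - 2 * J) * f ω) ∂sphereMeasure = 4 * π * ‖H‖ - (1 - 2 * J) * (4 * π * J) := by
    rw [integral_sub hfei (hfi.const_mul _), integral_const_mul, hIH, hIf]
  have hnn : 0 ≤ᵐ[sphereMeasure] fun ω => max (inner ℝ e (ω : EuclideanSpace ℝ (Fin 3))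
      - (1 - 2 * J)) 0 - (f ω * inner ℝ e (ω : EuclideanSpace ℝ (Fin 3)) - (1 - 2 * J) * f ω) := by
    filter_upwards [hbounds] with ω h
    simp only [Pi.zero_apply]
    rcases le_total (inner ℝ e (ω : EuclideanSpace ℝ (Fin 3)) - (1 - 2 * J)) 0 with h' | h'
    · rw [max_eq_right h']; nlinarith [h.1, h.2]
    · rw [max_eq_left h']; nlinarith [h.1, h.2]
  have hId := integral_sub hmi hgi
  rw [hF, hIg] at hId
  have hlt : 0 < ∫ ω, (max (inner ℝ e (ω : EuclideanSpace ℝ (Fin 3))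
      - (1 - 2 * J)) 0 - (f ω * inner ℝ e (ω : EuclideanSpace ℝ (Fin 3))
        - (1 - 2 * J) * f ω)) ∂sphereMeasure := by
    refine lt_of_le_of_ne (integral_nonneg_of_ae hnn) fun hz => ?_
    have h2 := (integral_eq_zero_iff_of_nonneg_ae hnn (hmi.sub hgi)).1 hz.symm
    have h3 : (fun ω : sphere (0 : EuclideanSpace ℝ (Fin 3)) 1 =>
        max (inner ℝ e (ω : EuclideanSpace ℝ (Fin 3)) - (1 - 2 * J)) 0)
        =ᵐ[sphereMeasure] fun _ => 0 := by
      filter_upwards [hbounds, h2] with ω h hω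
      simp only [Pi.zero_apply] at hω
      rcases le_or_gt (inner ℝ e (ω : EuclideanSpace ℝ (Fin 3)) - (1 - 2 * J)) 0 with h' | h'
      · exact max_eq_right h'
      · rw [max_eq_left h'.le] at hω
        nlinarith [mul_pos h' (sub_pos.2 h.2)]
    rw [integral_congr_ae h3, integral_zero] at hF
    have : 0 < π * (1 - (1 - 2 * J)) ^ 2 := by
      have : 1 - (1 - 2 * J) = 2 * J := by ring
      rw [this]; positivity
    linarith
  rw [hId] at hlt
  have : 0 < 4 * π * (J * (1 - J) - ‖H‖) := by nlinarith
  have := pos_of_mul_pos_right this (by positivity)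
  linarith
end

section
/- Let f : [−1,1] → ℝ be measurable with 0 < f(μ) < 1 for almost every μ ∈ [−1,1], and let J = ⟨f⟩, H = ⟨μ f⟩, K = ⟨μ² f⟩, where ⟨g⟩ = (1/2)∫_{−1}^{1} g(μ) dμ. Then both half-flux-split moment pairs Φ⁺ = ( (J+H)/2 , (H+K)/2 ) and Φ⁻ = ( (J−H)/2 , (H−K)/2 ) belong to the fermionic realizable set 𝓡_1. -/
open MeasureTheory

/-- `𝓡_1` viewed as a subset of `ℝ × ℝ`. -/
def realizableSet₁ : Set (ℝ × ℝ) :=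
  {M | 0 < M.1 ∧ M.1 < 1 ∧ |M.2| < M.1 * (1 - M.1)}

lemma core_aux (f : ℝ → ℝ) (hf : Measurable f) (h0 : ∀ x, 0 < f x) (h1 : ∀ x, f x < 1)
    (J H K : ℝ)
    (hJ : J = (1 / 2) * ∫ x in (-1 : ℝ)..1, f x)
    (hH : H = (1 / 2) * ∫ x in (-1 : ℝ)..1, x * f x)
    (hK : K = (1 / 2) * ∫ x in (-1 : ℝ)..1, x ^ 2 * f x) :
    ((J + H) / 2, (H + K) / 2) ∈ realizableSet₁ := by
  have hi : ∀ a b : ℝ, IntervalIntegrable f volume a b := by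
    intro a b
    refine (intervalIntegrable_const (c := (1 : ℝ))).mono_fun hf.aestronglyMeasurable ?_
    refine Filter.Eventually.of_forall fun x => ?_
    simp only [Real.norm_eq_abs, abs_one]
    rw [abs_of_pos (h0 x)]
    exact (h1 x).le
  have hp : ∀ (p : ℝ → ℝ), Continuous p → ∀ a b : ℝ,
      IntervalIntegrable (fun x => p x * f x) volume a b :=
    fun p hpc a b => (hi a b).continuousOn_mul hpc.continuousOn
  have lin : ∀ c d e : ℝ, ∫ x in (-1 : ℝ)..1, (c + d * x + e * x ^ 2) * f x
      = 2 * (c * J + d * H + e * K) := by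
    intro c d e
    have : ∀ x, (c + d * x + e * x ^ 2) * f x
      = c * f x + d * (x * f x) + e * (x ^ 2 * f x) := fun x => by ring
    simp_rw [this]
    have i1 := hi (-1) 1
    have i2 := hp (fun x => x) (by fun_prop) (-1) 1
    have i3 := hp (fun x => x ^ 2) (by fun_prop) (-1) 1
    rw [intervalIntegral.integral_add ((i1.const_mul c).add (i2.const_mul d)) (i3.const_mul e),
      intervalIntegral.integral_add (i1.const_mul c) (i2.const_mul d),
      intervalIntegral.integral_const_mul, intervalIntegral.integral_const_mul,
      intervalIntegral.integral_const_mul, hJ, hH, hK]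
    ring
  have apos : 0 < J + H := by
    have h : 0 < ∫ x in (-1 : ℝ)..1, (1 + 1 * x + 0 * x ^ 2) * f x := by
      refine intervalIntegral.intervalIntegral_pos_of_pos_on
        (hp (fun x => 1 + 1 * x + 0 * x ^ 2) (by fun_prop) _ _) ?_ (by norm_num)
      intro x hx
      exact mul_pos (by linarith [hx.1]) (h0 x)
    rw [lin] at h
    linarith
  have ale : J + H ≤ 1 := by
    have h : ∫ x in (-1 : ℝ)..1, (1 + 1 * x + 0 * x ^ 2) * f x ≤ ∫ x in (-1 : ℝ)..1, (1 + x) := by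
      refine intervalIntegral.integral_mono_on (by norm_num)
        (hp (fun x => 1 + 1 * x + 0 * x ^ 2) (by fun_prop) _ _)
        (Continuous.intervalIntegrable (by fun_prop) _ _) ?_
      intro x hx
      nlinarith [hx.1, h1 x]
    have h2 : ∫ x in (-1 : ℝ)..1, (1 + x) = 2 := by
      rw [intervalIntegral.integral_add (by simp) (by simp)]
      norm_num
    rw [lin, h2] at h
    linarith
  set t := J + H with ht
  have f2 : -(t ^ 2 / 2) ≤ 2 * ((1 - t) * J + (2 - t) * H + 1 * K) := by
    rw [← lin]
    have h : ∫ x in (-1 : ℝ)..1, (-(t ^ 2 / 4)) ≤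
        ∫ x in (-1 : ℝ)..1, ((1 - t) + (2 - t) * x + 1 * x ^ 2) * f x := by
      refine intervalIntegral.integral_mono_on (by norm_num) (by simp)
        (hp (fun x => (1 - t) + (2 - t) * x + 1 * x ^ 2) (by fun_prop) _ _) ?_
      intro x hx
      nlinarith [h0 x, h1 x, mul_nonneg (h0 x).le (sq_nonneg (1 + x - t / 2)),
        mul_nonneg (sq_nonneg t) (sub_nonneg.2 (h1 x).le)]
    rw [intervalIntegral.integral_const] at h
    refine le_trans (le_of_eq ?_) h
    simp only [smul_eq_mul]
    ring
  have f3 : -t ^ 2 + t ^ 3 / 6 ≤ 2 * ((1 - t) * J + (-t) * H + (-1) * K) := by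
    rw [← lin]
    have ii := hp (fun x => (1 - t) + (-t) * x + (-1) * x ^ 2) (by fun_prop)
    rw [← intervalIntegral.integral_add_adjacent_intervals (ii (-1) (1 - t)) (ii (1 - t) 1)]
    have ha : 0 ≤ ∫ x in (-1 : ℝ)..(1 - t), ((1 - t) + (-t) * x + (-1) * x ^ 2) * f x := by
      refine intervalIntegral.integral_nonneg (by linarith) ?_
      intro x hx
      refine mul_nonneg ?_ (h0 x).le
      nlinarith [mul_nonneg (show 0 ≤ 1 + x by linarith [hx.1])
        (show 0 ≤ 1 - t - x by linarith [hx.2])]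
    have hb : ∫ x in (1 - t)..1, ((1 - t) + (-t) * x + (-1) * x ^ 2) ≤
        ∫ x in (1 - t)..1, ((1 - t) + (-t) * x + (-1) * x ^ 2) * f x := by
      refine intervalIntegral.integral_mono_on (by linarith)
        (Continuous.intervalIntegrable (by fun_prop) _ _) (ii _ _) ?_
      intro x hx
      have : 0 ≤ -((1 - t) + (-t) * x + (-1) * x ^ 2) := by
        nlinarith [mul_nonneg (show 0 ≤ 1 + x by linarith [hx.1])
          (show 0 ≤ x - (1 - t) by linarith [hx.1])]
      nlinarith [mul_nonneg this (sub_nonneg.2 (h1 x).le)]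
    have hc : ∫ x in (1 - t)..1, ((1 - t) + (-t) * x + (-1) * x ^ 2) = -t ^ 2 + t ^ 3 / 6 := by
      rw [intervalIntegral.integral_add (Continuous.intervalIntegrable (by fun_prop) _ _)
          (Continuous.intervalIntegrable (by fun_prop) _ _),
        intervalIntegral.integral_add (Continuous.intervalIntegrable (by fun_prop) _ _)
          (Continuous.intervalIntegrable (by fun_prop) _ _),
        intervalIntegral.integral_const_mul, intervalIntegral.integral_const_mul,
        intervalIntegral.integral_const, integral_id, integral_pow]
      simp only [smul_eq_mul]
      norm_num
      ring
    linarith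
  have t3 : 0 < t ^ 3 := by positivity
  have t2 : 0 < t ^ 2 := by positivity
  have hJt : J = t - H := by linarith
  rw [hJt] at f2 f3
  refine ⟨by simp only; linarith, by simp only; linarith, ?_⟩
  simp only
  rw [abs_lt]
  constructor <;> nlinarith

theorem flux_splittings_realizable
    (f : ℝ → ℝ) (hf : Measurable f)
    (hbounds : ∀ᵐ μ ∂(volume.restrict (Set.Icc (-1 : ℝ) 1)), 0 < f μ ∧ f μ < 1)
    (J H K : ℝ)
    (hJ : J = (1 / 2) * ∫ μ in Set.Icc (-1 : ℝ) 1, f μ)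
    (hH : H = (1 / 2) * ∫ μ in Set.Icc (-1 : ℝ) 1, μ * f μ)
    (hK : K = (1 / 2) * ∫ μ in Set.Icc (-1 : ℝ) 1, μ ^ 2 * f μ) :
    ((J + H) / 2, (H + K) / 2) ∈ realizableSet₁ ∧
      ((J - H) / 2, (H - K) / 2) ∈ realizableSet₁ := by
  classical
  let g : ℝ → ℝ := fun x => if 0 < f x ∧ f x < 1 then f x else 1 / 2
  have hgm : Measurable g := by
    refine Measurable.ite ?_ hf measurable_const
    exact (measurableSet_lt measurable_const hf).inter (measurableSet_lt hf measurable_const)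
  have g0 : ∀ x, 0 < g x := by
    intro x
    simp only [g]
    split_ifs with h
    · exact h.1
    · norm_num
  have g1 : ∀ x, g x < 1 := by
    intro x
    simp only [g]
    split_ifs with h
    · exact h.2
    · norm_num
  have hfg : ∀ p : ℝ → ℝ, ∫ x in Set.Icc (-1 : ℝ) 1, p x * f x =
      ∫ x in (-1 : ℝ)..1, p x * g x := by
    intro p
    rw [intervalIntegral.integral_of_le (by norm_num), ← integral_Icc_eq_integral_Ioc]
    refine integral_congr_ae ?_
    filter_upwards [hbounds] with x hx
    simp only [g, if_pos hx]
  have e0 := hfg (fun _ => 1)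
  have e1 := hfg (fun x => x)
  have e2 := hfg (fun x => x ^ 2)
  simp only [one_mul] at e0
  rw [e0] at hJ
  rw [e1] at hH
  rw [e2] at hK
  refine ⟨core_aux g hgm g0 g1 J H K hJ hH hK, ?_⟩
  have r0 := intervalIntegral.integral_comp_neg (a := -1) (b := 1) (fun x => g x)
  have r1 := intervalIntegral.integral_comp_neg (a := -1) (b := 1) (fun x => x * g x)
  have r2 := intervalIntegral.integral_comp_neg (a := -1) (b := 1) (fun x => x ^ 2 * g x)
  simp only [neg_neg, neg_mul, even_two.neg_pow, intervalIntegral.integral_neg] at r0 r1 r2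
  have := core_aux (fun x => g (-x)) (hgm.comp measurable_neg) (fun x => g0 _) (fun x => g1 _)
    J (-H) K (by rw [hJ, r0]) (by rw [hH, ← r1]; ring) (by rw [hK, r2])
  obtain ⟨a, b, c⟩ := this
  simp only at a b c
  refine ⟨by simp only; linarith, by simp only; linarith, ?_⟩
  simp only
  rw [abs_lt] at c ⊢
  constructor <;> nlinarith [c.1, c.2]
end

section
/- Let d ≥ 1, λ ≥ 0, ξ ∈ [0,1], and J₀ ∈ (0,1). Suppose (J_N, H_N) ∈ 𝓡_d. Then the solution (J, H) of the implicit collision update J = J_N + λξ(J₀ − J), H = H_N − λH, namely J = (J_N + λξJ₀)/(1 + λξ) and H = H_N/(1 + λ), satisfies (J, H) ∈ 𝓡_d. -/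
theorem implicit_collision_step_realizable
    (d : ℕ) (hd : 1 ≤ d) (lam ξ J₀ : ℝ)
    (hlam : 0 ≤ lam) (hξ : ξ ∈ Set.Icc (0 : ℝ) 1) (hJ₀ : J₀ ∈ Set.Ioo (0 : ℝ) 1)
    (JN : ℝ) (HN : EuclideanSpace ℝ (Fin d))
    (hN : (JN, HN) ∈ realizableSet d)
    (J : ℝ) (H : EuclideanSpace ℝ (Fin d))
    (hJ : J = JN + lam * ξ * (J₀ - J))
    (hH : H = HN - (lam • H))
    (hJval : J = (JN + lam * ξ * J₀) / (1 + lam * ξ))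
    (hHval : H = (1 / (1 + lam)) • HN) :
    (J, H) ∈ realizableSet d := by
  obtain ⟨h1, h2, h3⟩ := hN
  obtain ⟨hx0, hx1⟩ := hξ
  obtain ⟨hj0, hj1⟩ := hJ₀
  simp only at h1 h2 h3
  have ha : 0 ≤ lam * ξ := mul_nonneg hlam hx0
  have hal : lam * ξ ≤ lam := mul_le_of_le_one_right hlam hx1
  clear hJval hH
  generalize lam * ξ = a at *
  have e : (1 + a) * J = JN + a * J₀ := by linarith
  have hpa : 0 < 1 + a := by linarith
  have hpl : 0 < 1 + lam := by linarith
  have hn : (1 + lam) * ‖H‖ = ‖HN‖ := by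
    rw [hHval, norm_smul, Real.norm_of_nonneg (by positivity)]
    field_simp
  have hJ0 : 0 < J := by
    have : 0 < (1 + a) * J := by rw [e]; positivity
    exact pos_of_mul_pos_right this hpa.le
  have hJ1 : J < 1 := by
    have : 0 < (1 + a) * (1 - J) := by
      have := mul_nonneg ha (sub_nonneg.2 hj1.le)
      nlinarith
    linarith [pos_of_mul_pos_right this hpa.le]
  refine ⟨hJ0, hJ1, ?_⟩
  show ‖H‖ < J * (1 - J)
  have id1 : (1 + a) * (J * (1 - J)) = JN * (1 - JN) + a * (J₀ * (1 - J₀))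
      + (JN - J) ^ 2 + a * (J₀ - J) ^ 2 := by
    linear_combination (1 - 2 * J) * e
  have p1 : 0 ≤ a * (J₀ * (1 - J₀)) := mul_nonneg ha (mul_nonneg hj0.le (by linarith))
  have p2 : 0 ≤ a * (J₀ - J) ^ 2 := by positivity
  have p3 : 0 ≤ (lam - a) * (J * (1 - J)) :=
    mul_nonneg (by linarith) (mul_nonneg hJ0.le (by linarith))
  have : (1 + lam) * ‖H‖ < (1 + lam) * (J * (1 - J)) := by
    linarith [sq_nonneg (JN - J)]
  exact lt_of_mul_lt_mul_left this hpl.le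
end

section
/- Let J_N, J₀ ∈ (0,1) and let 0 ≤ μ ≤ ν be real numbers. Set J = (J_N + μJ₀)/(1 + μ). Then (1 + ν)·J(1−J) ≥ J_N(1−J_N). In particular, if ‖H_N‖ < J_N(1−J_N), then ‖H_N‖/(1+ν) < J(1−J). -/
theorem relaxation_inequality
    (JN J₀ : ℝ) (hJN : JN ∈ Set.Ioo (0 : ℝ) 1) (hJ₀ : J₀ ∈ Set.Ioo (0 : ℝ) 1)
    (μ ν : ℝ) (hμ : 0 ≤ μ) (hμν : μ ≤ ν)
    (J : ℝ) (hJ : J = (JN + μ * J₀) / (1 + μ)) :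
    (1 + ν) * (J * (1 - J)) ≥ JN * (1 - JN) ∧
      ∀ {d : ℕ} (HN : EuclideanSpace ℝ (Fin d)),
        ‖HN‖ < JN * (1 - JN) → ‖HN‖ / (1 + ν) < J * (1 - J) := by
  obtain ⟨a0, a1⟩ := hJN
  obtain ⟨b0, b1⟩ := hJ₀
  have hp : 0 < 1 + μ := by linarith
  have hJ' : J * (1 + μ) = JN + μ * J₀ := by
    rw [hJ]; field_simp
  have key : (1 + μ) * (J * (1 - J)) = JN * (1 - JN) + μ * (J₀ * (1 - J₀))
      + ((JN - J) ^ 2 + μ * (J₀ - J) ^ 2) := by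
    linear_combination (1 - 2 * J) * hJ'
  have hN : 0 < JN * (1 - JN) := mul_pos a0 (by linarith)
  have h0 : 0 ≤ μ * (J₀ * (1 - J₀)) := mul_nonneg hμ (mul_nonneg b0.le (by linarith))
  have h1 : 0 ≤ (JN - J) ^ 2 + μ * (J₀ - J) ^ 2 := by positivity
  have h2 : JN * (1 - JN) ≤ (1 + μ) * (J * (1 - J)) := by linarith
  have h3 : 0 < J * (1 - J) := pos_of_mul_pos_right (lt_of_lt_of_le hN h2) hp.le
  have h4 : (1 + ν) * (J * (1 - J)) ≥ JN * (1 - JN) := by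
    have := mul_le_mul_of_nonneg_right hμν h3.le
    linarith
  refine ⟨h4, fun HN h => ?_⟩
  rw [div_lt_iff₀ (by linarith)]
  linarith
end

section
/- Let d ≥ 1, s ≥ 1, and let c_0, …, c_{s−1} ≥ 0 with c_0 + ⋯ + c_{s−1} = 1. Let a > 0, λ ≥ 0, ξ ∈ [0,1], J₀ ∈ (0,1), and let (J_j, H_j) ∈ 𝓡_d for j = 0, …, s−1. Suppose (J, H) ∈ ℝ × ℝ^d satisfies the implicit stage equations J = Σ_j c_j J_j + aλξ(J₀ − J) and H = Σ_j c_j H_j − aλH. Then (J, H) ∈ 𝓡_d. -/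
theorem wsum_pos_aux {s : ℕ} (c x : Fin s → ℝ) (hc : ∀ j, 0 ≤ c j) (hcsum : ∑ j, c j = 1)
    (hx : ∀ j, 0 < x j) : 0 < ∑ j, c j * x j := by
  have h0 : ∃ j, 0 < c j := by
    by_contra! h
    have : ∑ j, c j ≤ 0 := Finset.sum_nonpos (fun j _ => h j)
    linarith
  obtain ⟨j, hj⟩ := h0
  exact Finset.sum_pos' (fun i _ => mul_nonneg (hc i) (hx i).le)
    ⟨j, Finset.mem_univ j, mul_pos hj (hx j)⟩

theorem imex_stage_realizable
    (d s : ℕ) (hd : 1 ≤ d) (hs : 1 ≤ s)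
    (c : Fin s → ℝ) (hc : ∀ j, 0 ≤ c j) (hcsum : ∑ j, c j = 1)
    (a lam ξ J₀ : ℝ) (ha : 0 < a) (hlam : 0 ≤ lam)
    (hξ : ξ ∈ Set.Icc (0 : ℝ) 1) (hJ₀ : J₀ ∈ Set.Ioo (0 : ℝ) 1)
    (Jj : Fin s → ℝ) (Hj : Fin s → EuclideanSpace ℝ (Fin d))
    (hMj : ∀ j, (Jj j, Hj j) ∈ realizableSet d)
    (J : ℝ) (H : EuclideanSpace ℝ (Fin d))
    (hJ : J = ∑ j, c j * Jj j + a * lam * ξ * (J₀ - J))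
    (hH : H = ∑ j, c j • Hj j - (a * lam) • H) :
    (J, H) ∈ realizableSet d := by
  obtain ⟨hξ0, hξ1⟩ := hξ
  obtain ⟨h00, h01⟩ := hJ₀
  have hm : 0 ≤ a * lam := by positivity
  generalize a * lam = m at *
  have hk : 0 ≤ m * ξ := by positivity
  have hkm : m * ξ ≤ m := by nlinarith
  generalize m * ξ = k at *
  obtain ⟨S, hS⟩ : ∃ S, S = ∑ j, c j * Jj j := ⟨_, rfl⟩
  have hS0 : 0 < S := hS ▸ wsum_pos_aux c Jj hc hcsum (fun j => (hMj j).1)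
  have hS1 : S < 1 := by
    have := wsum_pos_aux c (fun j => 1 - Jj j) hc hcsum (fun j => sub_pos.2 (hMj j).2.1)
    simp only [mul_sub, mul_one, Finset.sum_sub_distrib, hcsum, ← hS] at this
    linarith
  have hK : ‖∑ j, c j • Hj j‖ < S * (1 - S) := by
    have h1 : ‖∑ j, c j • Hj j‖ ≤ ∑ j, c j * ‖Hj j‖ := by
      refine (norm_sum_le _ _).trans (le_of_eq (Finset.sum_congr rfl fun j _ => ?_))
      rw [norm_smul, Real.norm_of_nonneg (hc j)]
    have h2 := wsum_pos_aux c (fun j => Jj j * (1 - 2 * S) + S ^ 2 - ‖Hj j‖) hc hcsum (fun j => by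
      have : ‖Hj j‖ < Jj j * (1 - Jj j) := (hMj j).2.2
      nlinarith [sq_nonneg (Jj j - S)])
    simp only [mul_sub, mul_add, Finset.sum_sub_distrib, Finset.sum_add_distrib, ← mul_assoc,
      ← Finset.sum_mul, hcsum, ← hS, mul_one] at h2
    nlinarith
  rw [← hS] at hJ
  have hHn : (1 + m) * ‖H‖ = ‖∑ j, c j • Hj j‖ := by
    have : ∑ j, c j • Hj j = (1 + m) • H := by
      rw [add_smul, one_smul]
      exact (eq_sub_iff_add_eq.1 hH).symm
    rw [this, norm_smul, Real.norm_of_nonneg (by linarith)]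
  have hJ' : (1 + k) * J = S + k * J₀ := by linarith
  have hk1 : 0 < 1 + k := by linarith
  have hn := norm_nonneg H
  refine ⟨?_, ?_, ?_⟩
  · have : 0 < (1 + k) * J := by rw [hJ']; positivity
    exact pos_of_mul_pos_right this hk1.le
  · have : 0 < (1 + k) * (1 - J) := by nlinarith [mul_nonneg hk (sub_pos.2 h01).le]
    have := pos_of_mul_pos_right this hk1.le
    simpa using this
  · show ‖H‖ < J * (1 - J)
    have e : (1 + k) * (J * (1 - J)) = S * (1 - S) + k * (J₀ * (1 - J₀)) + (S - J) ^ 2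
        + k * (J₀ - J) ^ 2 := by
      linear_combination (1 - 2 * J) * hJ'
    have e1 : 0 ≤ k * (J₀ * (1 - J₀)) := mul_nonneg hk (mul_pos h00 (sub_pos.2 h01)).le
    have e2 : 0 ≤ k * (J₀ - J) ^ 2 := by positivity
    have e3 : (1 + k) * ‖H‖ ≤ (1 + m) * ‖H‖ := by gcongr
    refine lt_of_mul_lt_mul_left (a := 1 + k) ?_ hk1.le
    nlinarith [sq_nonneg (S - J)]
end

section
/- Let d ≥ 1, α ≥ 0, λ ≥ 0, ξ ∈ [0,1], and J₀ ∈ (0,1). Suppose (J̃, H̃) ∈ 𝓡_d, and let (J, H) ∈ ℝ × ℝ^d satisfy the implicit correction equations J = J̃ + αλ²ξ²(J₀ − J) and H = H̃ − αλ²H, i.e., J = (J̃ + αλ²ξ²J₀)/(1 + αλ²ξ²) and H = H̃/(1 + αλ²). Then (J, H) ∈ 𝓡_d. -/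
theorem implicit_correction_step_realizable
    (d : ℕ) (hd : 1 ≤ d) (α lam ξ J₀ : ℝ)
    (hα : 0 ≤ α) (hlam : 0 ≤ lam)
    (hξ : ξ ∈ Set.Icc (0 : ℝ) 1) (hJ₀ : J₀ ∈ Set.Ioo (0 : ℝ) 1)
    (Jt : ℝ) (Ht : EuclideanSpace ℝ (Fin d))
    (ht : (Jt, Ht) ∈ realizableSet d)
    (J : ℝ) (H : EuclideanSpace ℝ (Fin d))
    (hJ : J = Jt + α * lam ^ 2 * ξ ^ 2 * (J₀ - J))
    (hH : H = Ht - (α * lam ^ 2) • H)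
    (hJval : J = (Jt + α * lam ^ 2 * ξ ^ 2 * J₀) / (1 + α * lam ^ 2 * ξ ^ 2))
    (hHval : H = (1 / (1 + α * lam ^ 2)) • Ht) :
    (J, H) ∈ realizableSet d := by
  obtain ⟨h0, h1, h2⟩ := ht
  obtain ⟨hx0, hx1⟩ := hξ
  obtain ⟨hj0, hj1⟩ := hJ₀
  simp only at h0 h1 h2
  have ha : 0 ≤ α * lam ^ 2 := by positivity
  have hb : 0 ≤ α * lam ^ 2 * ξ ^ 2 := by positivity
  have hba : α * lam ^ 2 * ξ ^ 2 ≤ α * lam ^ 2 :=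
    mul_le_of_le_one_right ha (pow_le_one₀ hx0 hx1)
  have hn : ‖H‖ * (1 + α * lam ^ 2) = ‖Ht‖ := by
    rw [hHval, norm_smul, Real.norm_of_nonneg (by positivity)]
    field_simp
  clear hHval hH hJval
  generalize α * lam ^ 2 * ξ ^ 2 = b at *
  generalize α * lam ^ 2 = a at *
  have hJp : 0 < J := by
    by_contra hc
    nlinarith [mul_nonneg hb hj0.le]
  have hJ1 : J < 1 := by
    by_contra hc
    nlinarith [mul_nonneg hb (sub_pos.2 hj1).le]
  refine ⟨hJp, hJ1, ?_⟩
  show ‖H‖ < J * (1 - J)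
  have hle : (1 + b) * ‖H‖ ≤ ‖Ht‖ := by nlinarith [norm_nonneg H]
  have hid : (1 + b) * (J * (1 - J)) = Jt * (1 - Jt) + b * (J₀ * (1 - J₀))
      + (Jt - J) ^ 2 + b * (J₀ - J) ^ 2 := by
    have : Jt = J - b * (J₀ - J) := by linarith
    subst this
    ring
  have h3 : 0 ≤ b * (J₀ * (1 - J₀)) :=
    mul_nonneg hb (mul_nonneg hj0.le (sub_pos.2 hj1).le)
  have h4 : 0 ≤ b * (J₀ - J) ^ 2 := by positivity
  have h5 := sq_nonneg (Jt - J)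
  exact lt_of_mul_lt_mul_left (a := 1 + b) (by linarith) (by linarith)
end

section
/- Let V be a real vector space, R ⊆ V a convex set, and F : V → V a map such that Φ⁺(M₁) + Φ⁻(M₂) ∈ R for all M₁, M₂ ∈ R, where Φ^±(M) = (1/2)(M ± F(M)). Let 𝓕(a, b) = (1/2)(F(a) + F(b) − (b − a)) be the Lax–Friedrichs flux with α = 1. Let N ≥ 2, let ŵ_1, …, ŵ_N be positive weights with ŵ_1 + ⋯ + ŵ_N = 1 and ŵ_1 = ŵ_N, and let 0 ≤ λ ≤ 1. If M_1, …, M_N ∈ R (interior node values) and M_L, M_R ∈ R (exterior trace values), then Γ = Σ_{q=2}^{N−1} ŵ_q M_q + ŵ_1[M_1 + λ𝓕(M_L, M_1)] + ŵ_N[M_N − λ𝓕(M_N, M_R)] belongs to R. -/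
theorem gauss_lobatto_flux_update_realizable
    (V : Type*) [AddCommGroup V] [Module ℝ V]
    (R : Set V) (hR : Convex ℝ R) (F : V → V)
    (hsplit : ∀ M₁ ∈ R, ∀ M₂ ∈ R,
      (1 / 2 : ℝ) • (M₁ + F M₁) + (1 / 2 : ℝ) • (M₂ - F M₂) ∈ R)
    (LF : V → V → V) (hLF : ∀ a b, LF a b = (1 / 2 : ℝ) • (F a + F b - (b - a)))
    (N : ℕ) (hN : 2 ≤ N)
    (w : Fin N → ℝ) (hw : ∀ q, 0 < w q) (hwsum : ∑ q, w q = 1)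
    (hwends : w ⟨0, by omega⟩ = w ⟨N - 1, by omega⟩)
    (lam : ℝ) (hlam0 : 0 ≤ lam) (hlam1 : lam ≤ 1)
    (M : Fin N → V) (hM : ∀ q, M q ∈ R)
    (ML MR : V) (hML : ML ∈ R) (hMR : MR ∈ R) :
    (∑ q ∈ Finset.univ \ {(⟨0, by omega⟩ : Fin N), ⟨N - 1, by omega⟩}, w q • M q)
      + w ⟨0, by omega⟩ • (M ⟨0, by omega⟩ + lam • LF ML (M ⟨0, by omega⟩))
      + w ⟨N - 1, by omega⟩ • (M ⟨N - 1, by omega⟩ - lam • LF (M ⟨N - 1, by omega⟩) MR)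
      ∈ R := by
  obtain ⟨a, ha⟩ : ∃ a : Fin N, a = ⟨0, by omega⟩ := ⟨_, rfl⟩
  obtain ⟨b, hb⟩ : ∃ b : Fin N, b = ⟨N - 1, by omega⟩ := ⟨_, rfl⟩
  have hab : a ≠ b := by
    rw [ha, hb]
    intro h
    have := congrArg Fin.val h
    simp only at this
    omega
  rw [← ha, ← hb] at hwends ⊢
  let P : V := (1 - lam) • M a + lam • ((1 / 2 : ℝ) • (ML + F ML) + (1 / 2 : ℝ) • (MR - F MR))
  let Q : V := (1 - lam) • M b
    + lam • ((1 / 2 : ℝ) • (M a + F (M a)) + (1 / 2 : ℝ) • (M b - F (M b)))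
  have hP : P ∈ R := hR (hM a) (hsplit _ hML _ hMR) (by linarith) hlam0 (by ring)
  have hQ : Q ∈ R := hR (hM b) (hsplit _ (hM a) _ (hM b)) (by linarith) hlam0 (by ring)
  let M' : Fin N → V := fun q => if q = a then P else if q = b then Q else M q
  have hM' : ∀ q, M' q ∈ R := by
    intro q
    simp only [M']
    split_ifs
    · exact hP
    · exact hQ
    · exact hM q
  have key : ∑ q, w q • M' q ∈ R :=
    hR.sum_mem (fun q _ => (hw q).le) hwsum (fun q _ => hM' q)
  have hrest : ∑ q ∈ Finset.univ \ {a, b}, w q • M q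
      = ∑ q ∈ Finset.univ \ {a, b}, w q • M' q := by
    refine Finset.sum_congr rfl fun q hq => ?_
    simp only [Finset.mem_sdiff, Finset.mem_insert, Finset.mem_singleton, not_or] at hq
    simp only [M', if_neg hq.2.1, if_neg hq.2.2]
  rw [← Finset.sum_sdiff (Finset.subset_univ {a, b}), Finset.sum_pair hab] at key
  have e1 : M' a = P := by simp [M']
  have e2 : M' b = Q := by simp [M', hab.symm]
  rw [e1, e2, ← hrest] at key
  convert key using 1
  rw [add_assoc, hLF, hLF, hwends]
  congr 1
  simp only [P, Q]
  module
end

section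
/- Let d ≥ 1 and let F : ℝ × ℝ^d → ℝ × ℝ^d satisfy: Φ⁺(M₁) + Φ⁻(M₂) ∈ 𝓡_d for all M₁, M₂ ∈ 𝓡_d, where Φ^±(M) = (1/2)(M ± F(M)), and define 𝓕(a, b) = (1/2)(F(a) + F(b) − (b − a)). Let N ≥ 2, let ŵ_1, …, ŵ_N > 0 with Σ_q ŵ_q = 1 and ŵ_1 = ŵ_N, let 0 ≤ λ_F ≤ 1, let c_0, …, c_{s−1} ≥ 0 with Σ_j c_j = 1, let a > 0, λ_C ≥ 0, ξ ∈ [0,1], J₀ ∈ (0,1). For each j = 0, …, s−1, let M^{(j)}_1, …, M^{(j)}_N ∈ 𝓡_d and M^{(j)}_L, M^{(j)}_R ∈ 𝓡_d, and set Γ_j = Σ_{q=2}^{N−1} ŵ_q M^{(j)}_q + ŵ_1[M^{(j)}_1 + λ_F 𝓕(M^{(j)}_L, M^{(j)}_1)] + ŵ_N[M^{(j)}_N − λ_F 𝓕(M^{(j)}_N, M^{(j)}_R)]. Suppose (J, H) ∈ ℝ × ℝ^d satisfies the implicit stage equations J = Σ_j c_j (Γ_j)_J + aλ_C ξ(J₀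 − J) and H = Σ_j c_j (Γ_j)_H − aλ_C H, where (Γ_j)_J and (Γ_j)_H denote the density and flux components of Γ_j. Then (J, H) ∈ 𝓡_d. -/
theorem realizable_convex (d : ℕ) : Convex ℝ (realizableSet d) := by
  rintro ⟨x, X⟩ ⟨hx0, hx1, hx⟩ ⟨y, Y⟩ ⟨hy0, hy1, hy⟩ a b ha hb hab
  simp only at hx0 hx1 hx hy0 hy1 hy
  have hb' : b = 1 - a := by linarith
  have hn : ‖a • X + b • Y‖ ≤ a * ‖X‖ + b * ‖Y‖ := by
    refine (norm_add_le _ _).trans ?_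
    rw [norm_smul, norm_smul, Real.norm_of_nonneg ha, Real.norm_of_nonneg hb]
  have key : ∀ u v : ℝ, 0 < u → 0 < v → 0 < a * u + b * v := by
    intro u v hu hv
    rcases ha.eq_or_lt with h | h
    · have : b = 1 := by linarith
      rw [← h, this]; linarith
    · have := mul_pos h hu
      have := mul_nonneg hb hv.le
      linarith
  have k1 := key _ _ hx0 hy0
  have k2 := key _ _ (sub_pos.2 hx1) (sub_pos.2 hy1)
  have k3 := key _ _ (sub_pos.2 hx) (sub_pos.2 hy)
  have k4 := mul_nonneg (mul_nonneg ha hb) (sq_nonneg (x - y))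
  refine ⟨?_, ?_, ?_⟩
  · simpa using k1
  · simp only [Prod.fst_add, Prod.smul_fst, smul_eq_mul]
    linarith
  · simp only [Prod.fst_add, Prod.smul_fst, smul_eq_mul, Prod.snd_add, Prod.smul_snd]
    have e : (a * x + b * y) * (1 - (a * x + b * y))
      = a * (x * (1 - x)) + b * (y * (1 - y)) + a * b * (x - y) ^ 2 := by
      subst hb'; ring
    rw [e]; linarith

theorem dg_imex_stage_realizable
    (d : ℕ) (hd : 1 ≤ d)
    (F : ℝ × EuclideanSpace ℝ (Fin d) → ℝ × EuclideanSpace ℝ (Fin d))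
    (hsplit : ∀ M₁ ∈ realizableSet d, ∀ M₂ ∈ realizableSet d,
      (1 / 2 : ℝ) • (M₁ + F M₁) + (1 / 2 : ℝ) • (M₂ - F M₂) ∈ realizableSet d)
    (LF : ℝ × EuclideanSpace ℝ (Fin d) → ℝ × EuclideanSpace ℝ (Fin d) →
      ℝ × EuclideanSpace ℝ (Fin d))
    (hLF : ∀ a b, LF a b = (1 / 2 : ℝ) • (F a + F b - (b - a)))
    (N : ℕ) (hN : 2 ≤ N)
    (w : Fin N → ℝ) (hw : ∀ q, 0 < w q) (hwsum : ∑ q, w q = 1)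
    (hwends : w ⟨0, by omega⟩ = w ⟨N - 1, by omega⟩)
    (lamF : ℝ) (hlamF0 : 0 ≤ lamF) (hlamF1 : lamF ≤ 1)
    (s : ℕ) (hs : 1 ≤ s)
    (c : Fin s → ℝ) (hc : ∀ j, 0 ≤ c j) (hcsum : ∑ j, c j = 1)
    (a lamC ξ J₀ : ℝ) (ha : 0 < a) (hlamC : 0 ≤ lamC)
    (hξ : ξ ∈ Set.Icc (0 : ℝ) 1) (hJ₀ : J₀ ∈ Set.Ioo (0 : ℝ) 1)
    (M : Fin s → Fin N → ℝ × EuclideanSpace ℝ (Fin d))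
    (hM : ∀ j q, M j q ∈ realizableSet d)
    (ML MR : Fin s → ℝ × EuclideanSpace ℝ (Fin d))
    (hML : ∀ j, ML j ∈ realizableSet d) (hMR : ∀ j, MR j ∈ realizableSet d)
    (Γ : Fin s → ℝ × EuclideanSpace ℝ (Fin d))
    (hΓ : ∀ j, Γ j =
      (∑ q ∈ Finset.univ \ {(⟨0, by omega⟩ : Fin N), ⟨N - 1, by omega⟩}, w q • M j q)
        + w ⟨0, by omega⟩ • (M j ⟨0, by omega⟩ + lamF • LF (ML j) (M j ⟨0, by omega⟩))
        + w ⟨N - 1, by omega⟩ •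
            (M j ⟨N - 1, by omega⟩ - lamF • LF (M j ⟨N - 1, by omega⟩) (MR j)))
    (J : ℝ) (H : EuclideanSpace ℝ (Fin d))
    (hJ : J = ∑ j, c j * (Γ j).1 + a * lamC * ξ * (J₀ - J))
    (hH : H = ∑ j, c j • (Γ j).2 - (a * lamC) • H) :
    (J, H) ∈ realizableSet d := by
  have hconv := realizable_convex d
  set i0 : Fin N := ⟨0, by omega⟩ with hi0
  set i1 : Fin N := ⟨N - 1, by omega⟩ with hi1
  have hne : i0 ≠ i1 := by
    rw [hi0, hi1, Ne, Fin.mk.injEq]; omega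
  have hG : ∀ j, Γ j ∈ realizableSet d := by
    intro j
    let A := (1 - lamF) • M j i0 + lamF •
      ((1 / 2 : ℝ) • (ML j + F (ML j)) + (1 / 2 : ℝ) • (M j i1 - F (M j i1)))
    let B := (1 - lamF) • M j i1 + lamF •
      ((1 / 2 : ℝ) • (M j i0 + F (M j i0)) + (1 / 2 : ℝ) • (MR j - F (MR j)))
    have hA : A ∈ realizableSet d :=
      hconv (hM j i0) (hsplit _ (hML j) _ (hM j i1)) (by linarith) hlamF0 (by ring)
    have hB : B ∈ realizableSet d :=
      hconv (hM j i1) (hsplit _ (hM j i0) _ (hMR j)) (by linarith) hlamF0 (by ring)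
    let G : Fin N → ℝ × EuclideanSpace ℝ (Fin d) :=
      fun q => if q = i0 then A else if q = i1 then B else M j q
    have hGm : ∀ q ∈ Finset.univ, G q ∈ realizableSet d := by
      intro q _
      simp only [G]
      split_ifs
      · exact hA
      · exact hB
      · exact hM j q
    have hmem := hconv.sum_mem (fun q _ => (hw q).le) hwsum hGm
    have : Γ j = ∑ q, w q • G q := by
      rw [hΓ j, ← Finset.sum_sdiff (Finset.subset_univ {i0, i1}), Finset.sum_pair hne, add_assoc]
      congr 1
      · refine Finset.sum_congr rfl fun q hq => ?_
        simp only [Finset.mem_sdiff, Finset.mem_univ, Finset.mem_insert, Finset.mem_singleton,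
          true_and, not_or] at hq
        simp [G, hq.1, hq.2]
      · have e0 : G i0 = A := by simp [G]
        have e1 : G i1 = B := by simp [G, hne.symm]
        rw [e0, e1, hLF, hLF, ← hwends]
        simp only [A, B]
        module
    rw [this]; exact hmem
  have hS := hconv.sum_mem (fun j _ => hc j) hcsum (fun j (_ : j ∈ Finset.univ) => hG j)
  have e1 : (∑ j, c j • Γ j).1 = ∑ j, c j * (Γ j).1 := by simp [Prod.fst_sum]
  have e2 : (∑ j, c j • Γ j).2 = ∑ j, c j • (Γ j).2 := by simp [Prod.snd_sum]
  rw [← e1] at hJ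
  rw [← e2] at hH
  generalize (∑ j, c j • Γ j) = S at hS hJ hH
  have hk : 0 ≤ a * lamC := mul_nonneg ha.le hlamC
  generalize a * lamC = k at hk hJ hH
  have hp : 0 ≤ k * ξ := mul_nonneg hk hξ.1
  have hpk : k * ξ ≤ k := mul_le_of_le_one_right hk hξ.2
  generalize k * ξ = p at hp hpk hJ
  have hp1 : 0 < 1 + p := by linarith
  have hZ : ((J₀, 0) : ℝ × EuclideanSpace ℝ (Fin d)) ∈ realizableSet d :=
    ⟨hJ₀.1, hJ₀.2, by simpa using mul_pos hJ₀.1 (sub_pos.2 hJ₀.2)⟩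
  have hT := hconv hS hZ (a := 1 / (1 + p)) (b := p / (1 + p)) (by positivity) (by positivity)
    (by field_simp)
  obtain ⟨h1, h2, h3⟩ := hT
  have eJ : ((1 / (1 + p)) • S + (p / (1 + p)) • ((J₀, 0) : ℝ × EuclideanSpace ℝ (Fin d))).1 = J := by
    simp only [Prod.fst_add, Prod.smul_fst, smul_eq_mul]
    field_simp
    linarith
  have eH : ((1 / (1 + p)) • S + (p / (1 + p)) • ((J₀, 0) : ℝ × EuclideanSpace ℝ (Fin d))).2
      = ((1 + k) / (1 + p)) • H := by
    have : S.2 = (1 + k) • H := by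
      rw [add_smul, one_smul]; exact (eq_sub_iff_add_eq.1 hH).symm
    simp only [Prod.snd_add, Prod.smul_snd, smul_zero, add_zero]
    rw [this, smul_smul]
    congr 1
    ring
  rw [eJ] at h1 h2 h3
  rw [eH, norm_smul, Real.norm_of_nonneg (by positivity)] at h3
  refine ⟨h1, h2, lt_of_le_of_lt ?_ h3⟩
  exact le_mul_of_one_le_left (norm_nonneg _) ((one_le_div hp1).2 (by linarith))
end

section
/- Let d ≥ 1, let J₀ ∈ (0,1), and let 0 ≤ μ ≤ ν be real numbers. If (J_N, H_N) ∈ 𝓡_d, then the relaxed-and-damped moment pair ( (J_N + μJ₀)/(1 + μ) , H_N/(1 + ν) ) belongs to 𝓡_d. -/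
theorem relax_and_damp_realizable
    (d : ℕ) (hd : 1 ≤ d) (J₀ : ℝ) (hJ₀ : J₀ ∈ Set.Ioo (0 : ℝ) 1)
    (μ ν : ℝ) (hμ : 0 ≤ μ) (hμν : μ ≤ ν)
    (JN : ℝ) (HN : EuclideanSpace ℝ (Fin d))
    (hN : (JN, HN) ∈ realizableSet d) :
    ((JN + μ * J₀) / (1 + μ), (1 / (1 + ν)) • HN) ∈ realizableSet d := by
  obtain ⟨h0, h1⟩ := hJ₀
  obtain ⟨hJ0, hJ1, hH⟩ := hN
  simp only at hJ0 hJ1 hH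
  have hm : 0 < 1 + μ := by linarith
  have hn : 0 < 1 + ν := by linarith
  have hμJ : 0 ≤ μ * J₀ := mul_nonneg hμ h0.le
  have hμJ' : 0 ≤ μ * (1 - J₀) := mul_nonneg hμ (by linarith)
  refine ⟨div_pos (by linarith) hm, (div_lt_one hm).2 (by linarith), ?_⟩
  change ‖(1 / (1 + ν)) • HN‖ < (JN + μ * J₀) / (1 + μ) * (1 - (JN + μ * J₀) / (1 + μ))
  rw [norm_smul, Real.norm_of_nonneg (by positivity)]
  have e1 : 1 / (1 + ν) * ‖HN‖ ≤ 1 / (1 + μ) * ‖HN‖ :=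
    mul_le_mul_of_nonneg_right (one_div_le_one_div_of_le hm (by linarith)) (norm_nonneg _)
  have e2 : 1 / (1 + μ) * ‖HN‖ < 1 / (1 + μ) * (JN * (1 - JN)) :=
    mul_lt_mul_of_pos_left hH (by positivity)
  have e3 : (JN + μ * J₀) / (1 + μ) * (1 - (JN + μ * J₀) / (1 + μ)) - 1 / (1 + μ) * (JN * (1 - JN))
      = (μ * ((JN - J₀) ^ 2 + (1 + μ) * (J₀ * (1 - J₀)))) / (1 + μ) ^ 2 := by
    field_simp
    ring
  have e4 : 0 ≤ (μ * ((JN - J₀) ^ 2 + (1 + μ) * (J₀ * (1 - J₀)))) / (1 + μ) ^ 2 := by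
    have : 0 < 1 - J₀ := by linarith
    positivity
  linarith
end
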